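/- Let G be a finite simple graph with at least one vertex. The cut ideal I_G is generated by polynomials of degree at most 2 if and only if G has no K₄ minor. -/

import Mathlib

open MvPolynomial

noncomputable section

/-- `sep A e` is `true` iff the edge `e` has exactly one endpoint in `A`. -/
def sep {V : Type} [DecidableEq V] (A : Finset V) : Sym2 V → Bool :=
  Sym2.lift ⟨fun a b => (decide (a ∈ A)).xor (decide (b ∈ A)),
    fun _ _ => Bool.xor_comm _ _⟩

/-- The cut map `φ_G : K[q_A : v₀ ∈ A ⊆ V] → K[s_e, t_e : e ∈ E]`, where
`s_e` is the variable `X (e, true)` and `t_e` is the variable `X (e, false)`. -/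
def cutMap (K : Type) [Field K] {V : Type} [Fintype V] [DecidableEq V]
    (G : SimpleGraph V) (v₀ : V) :
    MvPolynomial {A : Finset V // v₀ ∈ A} K →ₐ[K] MvPolynomial (Sym2 V × Bool) K :=
  aeval fun A : {A : Finset V // v₀ ∈ A} =>
    ∏ e ∈ (Set.toFinite G.edgeSet).toFinset, X (e, sep A.1 e)

/-- The cut ideal `I_G`, i.e. the kernel of `φ_G`. -/
def cutIdeal (K : Type) [Field K] {V : Type} [Fintype V] [DecidableEq V]
    (G : SimpleGraph V) (v₀ : V) :
    Ideal (MvPolynomial {A : Finset V // v₀ ∈ A} K) :=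
  RingHom.ker (cutMap K G v₀)

/-- `G` has a `K₄` minor: there are four pairwise disjoint nonempty vertex subsets,
each inducing a connected subgraph, with an edge of `G` between every two of them. -/
def HasK4Minor {V : Type} [DecidableEq V] (G : SimpleGraph V) : Prop :=
  ∃ W : Fin 4 → Finset V,
    (∀ i, (W i).Nonempty) ∧
    (∀ i j, i ≠ j → Disjoint (W i) (W j)) ∧
    (∀ i, (G.comap (Subtype.val : {x : V // x ∈ W i} → V)).Connected) ∧
    (∀ i j, i ≠ j → ∃ a ∈ W i, ∃ b ∈ W j, G.Adj a b)


/-! ### Part 1: a K₄-minor-free graph has a good vertex -/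

section GraphPart
set_option linter.unusedSectionVars false
variable {V : Type} [DecidableEq V]

theorem conn_of_root (G : SimpleGraph V) (W : Finset V) (r : V) (hr : r ∈ W)
    (h : ∀ y ∈ W, Relation.ReflTransGen (fun x y => G.Adj x y ∧ x ∈ W ∧ y ∈ W) r y) :
    (G.comap (Subtype.val : {x : V // x ∈ W} → V)).Connected := by
  have key : ∀ y, Relation.ReflTransGen (fun x y => G.Adj x y ∧ x ∈ W ∧ y ∈ W) r y →
      ∃ hy : y ∈ W, (G.comap (Subtype.val : {x : V // x ∈ W} → V)).Reachable ⟨r, hr⟩ ⟨y, hy⟩ := by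
    intro y hy
    induction hy with
    | refl => exact ⟨hr, SimpleGraph.Reachable.refl _⟩
    | tail _ hbc ih =>
      obtain ⟨hb, hreach⟩ := ih
      refine ⟨hbc.2.2, hreach.trans ?_⟩
      apply SimpleGraph.Adj.reachable
      exact hbc.1
  rw [SimpleGraph.connected_iff_exists_forall_reachable]
  refine ⟨⟨r, hr⟩, ?_⟩
  rintro ⟨y, hy⟩
  exact (key y (h y hy)).2

theorem root_of_conn (G : SimpleGraph V) (W : Finset V)
    (h : (G.comap (Subtype.val : {x : V // x ∈ W} → V)).Connected) (r y : V) (hr : r ∈ W)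
    (hy : y ∈ W) :
    Relation.ReflTransGen (fun x y => G.Adj x y ∧ x ∈ W ∧ y ∈ W) r y := by
  have := h.preconnected ⟨r, hr⟩ ⟨y, hy⟩
  rw [SimpleGraph.reachable_iff_reflTransGen] at this
  have h2 := Relation.ReflTransGen.lift (p := fun x y => G.Adj x y ∧ x ∈ W ∧ y ∈ W)
    (Subtype.val : {x : V // x ∈ W} → V)
    (fun a b hab => ⟨hab, a.2, b.2⟩) _ _ this
  exact h2

theorem chain_rtg (G : SimpleGraph V) (P : V → Prop) (x : V) (l : List V) (hc : (x :: l).IsChain G.Adj)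
    (hP : ∀ y ∈ x :: l, P y) :
    ∀ y ∈ x :: l, Relation.ReflTransGen (fun x y => G.Adj x y ∧ P x ∧ P y) x y := by
  induction l generalizing x with
  | nil => intro y hy; simp at hy; subst hy; exact .refl
  | cons z l ih =>
    intro y hy
    rw [List.isChain_cons_cons] at hc
    rcases List.mem_cons.1 hy with rfl | hy
    · exact .refl
    · refine Relation.ReflTransGen.head ⟨hc.1, hP _ (by simp), hP _ (by simp)⟩ ?_
      exact ih z hc.2 (fun y hy => hP y (List.mem_cons_of_mem _ hy)) y hy

theorem chain_conn (G : SimpleGraph V) (l : List V) (hl : l ≠ []) (hc : l.IsChain G.Adj) :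
    (G.comap (Subtype.val : {x : V // x ∈ l.toFinset} → V)).Connected := by
  cases l with
  | nil => exact absurd rfl hl
  | cons x l =>
    apply conn_of_root G _ x (by simp)
    intro y hy
    exact chain_rtg G (fun y => y ∈ (x :: l).toFinset) x l hc (fun y hy => by simpa using hy) y
      (by simpa using hy)

/-- delete all edges at `v` -/
def delV (G : SimpleGraph V) (v : V) : SimpleGraph V where
  Adj x y := G.Adj x y ∧ x ≠ v ∧ y ≠ v
  symm := ⟨fun _ _ h => ⟨h.1.symm, h.2.2, h.2.1⟩⟩
  loopless := ⟨fun _ h => G.irrefl h.1⟩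

/-- delete all edges at `v` and add the edge `ab` -/
def delAdd (G : SimpleGraph V) (v a b : V) : SimpleGraph V where
  Adj x y := (delV G v).Adj x y ∨ (x ≠ y ∧ ((x = a ∧ y = b) ∨ (x = b ∧ y = a)))
  symm := ⟨fun _ _ h => h.elim (fun h => Or.inl h.symm) (fun h => Or.inr ⟨h.1.symm, h.2.symm.imp And.symm And.symm⟩)⟩
  loopless := ⟨fun _ h => h.elim (fun h => (delV G v).irrefl h) (fun h => h.1 rfl)⟩

theorem minor_mono {G H : SimpleGraph V} (hGH : ∀ x y, G.Adj x y → H.Adj x y) (h : HasK4Minor G) :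
    HasK4Minor H := by
  obtain ⟨W, h1, h2, h3, h4⟩ := h
  refine ⟨W, h1, h2, fun i => ?_, fun i j hij => ?_⟩
  · obtain ⟨r, hr⟩ := h1 i
    apply conn_of_root H _ r hr
    intro y hy
    exact Relation.ReflTransGen.mono (fun a b h => ⟨hGH _ _ h.1, h.2⟩) _ _ (root_of_conn G _ (h3 i) r y hr hy)
  · obtain ⟨a, ha, b, hb, hab⟩ := h4 i j hij
    exact ⟨a, ha, b, hb, hGH _ _ hab⟩

theorem minor_delAdd {G : SimpleGraph V} {v a b : V} (hva : G.Adj v a) (hvb : G.Adj v b)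
    (h : HasK4Minor (delAdd G v a b)) : HasK4Minor G := by
  obtain ⟨W, h1, h2, h3, h4⟩ := h
  have hiso : ∀ x, ¬ (delAdd G v a b).Adj v x := by
    rintro x (h | ⟨-, ⟨h, -⟩ | ⟨h, -⟩⟩)
    · exact h.2.1 rfl
    · exact G.irrefl (h ▸ hva)
    · exact G.irrefl (h ▸ hvb)
  have hv : ∀ i, v ∉ W i := by
    intro i hi
    obtain ⟨j, hj⟩ : ∃ j, i ≠ j := ⟨i + 1, by clear hi; revert i; decide⟩
    obtain ⟨c, hc, d, hd, hcd⟩ := h4 i j hj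
    have := root_of_conn _ _ (h3 i) v c hi hc
    rcases Relation.ReflTransGen.cases_head this with rfl | ⟨e, he, -⟩
    · exact hiso _ hcd
    · exact hiso _ he.1
  let W' : Fin 4 → Finset V := fun i => if a ∈ W i then insert v (W i) else W i
  have hsub : ∀ i x, x ∈ W i → x ∈ W' i := by
    intro i x hx; simp only [W']; split_ifs <;> simp [hx]
  have hW' : ∀ i x, x ∈ W' i → x ∈ W i ∨ (x = v ∧ a ∈ W i) := by
    intro i x hx; simp only [W'] at hx; split_ifs at hx with h
    · simp at hx; tauto
    · tauto
  have hvW : ∀ i, a ∈ W i → v ∈ W' i := by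
    intro i hi; simp [W', hi]
  have haa : ∀ i j, a ∈ W i → a ∈ W j → i = j := by
    intro i j hi hj
    by_contra hij
    exact Finset.disjoint_left.1 (h2 i j hij) hi hj
  refine ⟨W', fun i => ?_, fun i j hij => ?_, fun i => ?_, fun i j hij => ?_⟩
  · obtain ⟨x, hx⟩ := h1 i
    exact ⟨x, hsub i x hx⟩
  · rw [Finset.disjoint_left]
    intro x hx hy
    rcases hW' i x hx with h | ⟨h, h'⟩ <;> rcases hW' j x hy with k | ⟨k, k'⟩
    · exact Finset.disjoint_left.1 (h2 i j hij) h k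
    · exact hv _ (k ▸ h)
    · exact hv _ (h ▸ k)
    · exact hij (haa _ _ h' k')
  · obtain ⟨r, hr⟩ := h1 i
    apply conn_of_root G _ r (hsub i r hr)
    have key : ∀ y, y ∈ W i → Relation.ReflTransGen (fun x y => G.Adj x y ∧ x ∈ W' i ∧ y ∈ W' i) r y := by
      intro y hy
      have := root_of_conn _ _ (h3 i) r y hr hy
      clear hy
      induction this with
      | refl => exact .refl
      | tail _ hbc ih =>
        rcases hbc with ⟨h | ⟨-, ⟨rfl, rfl⟩ | ⟨rfl, rfl⟩⟩, hb, hc⟩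
        · exact ih.tail ⟨h.1, hsub _ _ hb, hsub _ _ hc⟩
        · exact (ih.tail ⟨hva.symm, hsub _ _ hb, hvW _ hb⟩).tail ⟨hvb, hvW _ hb, hsub _ _ hc⟩
        · exact (ih.tail ⟨hvb.symm, hsub _ _ hb, hvW _ hc⟩).tail ⟨hva, hvW _ hc, hsub _ _ hc⟩
    intro y hy
    rcases hW' i y hy with h | ⟨rfl, h⟩
    · exact key y h
    · exact (key a h).tail ⟨hva.symm, hsub _ _ h, hvW _ h⟩
  · obtain ⟨c, hc, d, hd, hcd⟩ := h4 i j hij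
    rcases hcd with h | ⟨-, ⟨rfl, rfl⟩ | ⟨rfl, rfl⟩⟩
    · exact ⟨c, hsub _ _ hc, d, hsub _ _ hd, h.1⟩
    · exact ⟨v, hvW _ hc, d, hsub _ _ hd, hvb⟩
    · exact ⟨c, hsub _ _ hc, v, hvW _ hd, hvb.symm⟩

/-- the data of a rotatable path of length `N` -/
def Tup (G : SimpleGraph V) (N : ℕ) (x : V) (M : List V) (b c : V) (D : List V) : Prop :=
  ((x :: M) ++ b :: c :: D).IsChain G.Adj ∧ ((x :: M) ++ b :: c :: D).Nodup ∧ G.Adj x c ∧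
    ((x :: M) ++ b :: c :: D).length = N

/-- `v` has one or two neighbours, which are connected in the rest. -/
def GoodV (G : SimpleGraph V) (v : V) : Prop :=
  ∃ a b, (∀ u, G.Adj v u ↔ u = a ∨ u = b) ∧ (delV G v).Reachable a b

theorem Tup.rev {G : SimpleGraph V} {N : ℕ} {x : V} {M : List V} {b c : V} {D : List V}
    (h : Tup G N x M b c D) : Tup G N b M.reverse x c D := by
  obtain ⟨h1, h2, h3, h4⟩ := h
  have e1 : (x :: M) ++ b :: c :: D = (x :: M ++ [b]) ++ (c :: D) := by simp
  have e2 : (b :: M.reverse) ++ x :: c :: D = (x :: M ++ [b]).reverse ++ (c :: D) := by simp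
  rw [e1, List.isChain_append] at h1
  obtain ⟨h1, h1', h1''⟩ := h1
  refine ⟨?_, ?_, ?_, ?_⟩
  · rw [e2, List.isChain_append]
    refine ⟨?_, h1', ?_⟩
    · rw [List.isChain_reverse]
      exact h1.imp (fun _ _ h => h.symm)
    · rw [List.getLast?_reverse]
      simp
      exact h3
  · rw [e2]
    rw [e1] at h2
    rw [List.nodup_append] at h2 ⊢
    refine ⟨List.nodup_reverse.2 h2.1, h2.2.1, ?_⟩
    intro a ha
    exact h2.2.2 a (List.mem_reverse.1 ha)
  · have := h1'' b (by rw [List.getLast?_append]; simp) c (by simp)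
    exact this
  · rw [e1] at h4; rw [e2]; simpa using h4

theorem Tup.nbr {G : SimpleGraph V} {N : ℕ} 
    (hN : ∀ l : List V, l.IsChain G.Adj → l.Nodup → l.length ≤ N)
    {x : V} {M : List V} {b c : V} {D : List V}
    (h : Tup G N x M b c D) (hmin : ∀ x' M' b' c' D', Tup G N x' M' b' c' D' → M.length ≤ M'.length) :
    GoodV G x ∨ ∃ d ∈ D, G.Adj x d := by
  by_contra hcon
  push Not at hcon
  obtain ⟨hg, hD⟩ := hcon
  obtain ⟨h1, h2, h3, h4⟩ := h
  obtain ⟨x1, M', hM⟩ : ∃ x1 M', M ++ [b] = x1 :: M' := by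
    cases M with
    | nil => exact ⟨b, [], rfl⟩
    | cons y M => exact ⟨y, M ++ [b], rfl⟩
  have hlen : M.length = M'.length := by
    have := congrArg List.length hM
    simpa using this
  have e1 : (x :: M) ++ b :: c :: D = x :: x1 :: (M' ++ c :: D) := by
    have : M ++ b :: c :: D = (M ++ [b]) ++ c :: D := by simp
    rw [List.cons_append, this, hM]; simp
  rw [e1] at h1 h2 h4
  apply hg
  have hx1 : G.Adj x x1 := (List.isChain_cons_cons.1 h1).1
  have hch := (List.isChain_cons_cons.1 h1).2
  refine ⟨x1, c, fun u => ⟨fun hu => ?_, ?_⟩, ?_⟩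
  · have hmem : u ∈ x :: x1 :: (M' ++ c :: D) := by
      by_contra hu'
      have := hN (u :: x :: x1 :: (M' ++ c :: D)) (List.isChain_cons_cons.2 ⟨hu.symm, h1⟩)
        (List.nodup_cons.2 ⟨hu', h2⟩)
      rw [List.length_cons] at this
      omega
    simp only [List.mem_cons, List.mem_append] at hmem
    rcases hmem with rfl | h | h | h | h
    · exact absurd hu (G.irrefl)
    · exact Or.inl h
    · exfalso
      obtain ⟨M1, M2, rfl⟩ := List.append_of_mem h
      rcases List.eq_nil_or_concat M1 with rfl | ⟨M0, y, rfl⟩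
      · have := hmin x [] x1 u (M2 ++ c :: D) ⟨by simpa using h1, by simpa using h2, hu, by simpa using h4⟩
        rw [hlen] at this; simp at this
      · have := hmin x (x1 :: M0) y u (M2 ++ c :: D) ⟨by simpa using h1, by simpa using h2, hu, by simpa using h4⟩
        simp at this hlen; omega
    · exact Or.inr h
    · exact absurd hu (hD u h)
  · rintro (rfl | rfl)
    · exact hx1
    · exact h3
  · have := chain_rtg G (fun y => y ≠ x) x1 (M' ++ c :: D) hch (by
      intro y hy
      rintro rfl
      exact (List.nodup_cons.1 h2).1 hy) c (by simp)
    rw [SimpleGraph.reachable_iff_reflTransGen]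
    exact this

theorem exists_good_vertex [Fintype V] (G : SimpleGraph V) (hG : ¬ HasK4Minor G)
    (hE : ∃ u w, G.Adj u w) : ∃ v, GoodV G v := by
  by_contra hno
  push Not at hno
  obtain ⟨u, w, huw⟩ := hE
  -- longest path
  have hbd : ∀ l : List V, l.Nodup → l.length ≤ Fintype.card V := fun l hl => hl.length_le_card
  let P : ℕ → Prop := fun n => ∃ l : List V, l.IsChain G.Adj ∧ l.Nodup ∧ l.length = n
  have : DecidablePred P := Classical.decPred P
  have hP2 : P 2 := ⟨[u, w], by simpa using huw, by simpa using huw.ne, rfl⟩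
  have hP2' : 2 ≤ Fintype.card V := by
    obtain ⟨l, _, h2, h3⟩ := hP2
    rw [← h3]; exact hbd l h2
  set N := Nat.findGreatest P (Fintype.card V) with hNdef
  have hN2 : 2 ≤ N := Nat.le_findGreatest hP2' hP2
  have hPN : P N := Nat.findGreatest_spec hP2' hP2
  have hN : ∀ l : List V, l.IsChain G.Adj → l.Nodup → l.length ≤ N := by
    intro l h1 h2
    exact Nat.le_findGreatest (hbd l h2) ⟨l, h1, h2, rfl⟩
  -- a tuple exists
  have htup : ∃ k, ∃ x M b c D, Tup G N x M b c D ∧ M.length = k := by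
    obtain ⟨l, h1, h2, h3⟩ := hPN
    match l, h1, h2, h3 with
    | [], _, _, h3 => simp at h3; omega
    | [_], _, _, h3 => simp at h3; omega
    | x :: x1 :: t, h1, h2, h3 =>
      have hx1 : G.Adj x x1 := (List.isChain_cons_cons.1 h1).1
      have : ∃ z, G.Adj x z ∧ z ≠ x1 := by
        by_contra hz
        push Not at hz
        refine hno x ⟨x1, x1, fun u => ⟨fun hu => Or.inl (hz u hu), ?_⟩, SimpleGraph.Reachable.refl _⟩
        rintro (rfl | rfl) <;> exact hx1
      obtain ⟨z, hz, hzx⟩ := this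
      have hmem : z ∈ x :: x1 :: t := by
        by_contra hu'
        have := hN (z :: x :: x1 :: t) (List.isChain_cons_cons.2 ⟨hz.symm, h1⟩)
          (List.nodup_cons.2 ⟨hu', h2⟩)
        rw [List.length_cons] at this
        omega
      simp only [List.mem_cons] at hmem
      rcases hmem with rfl | h | h
      · exact absurd hz G.irrefl
      · exact absurd h hzx
      · obtain ⟨M1, M2, rfl⟩ := List.append_of_mem h
        rcases List.eq_nil_or_concat M1 with rfl | ⟨M0, y, rfl⟩
        · exact ⟨_, x, [], x1, z, M2, ⟨by simpa using h1, by simpa using h2, hz, by simpa using h3⟩, rfl⟩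
        · exact ⟨_, x, x1 :: M0, y, z, M2, ⟨by simpa using h1, by simpa using h2, hz, by simpa using h3⟩, rfl⟩
  obtain ⟨k, ⟨x, M, b, c, D, hT, hk⟩, hkmin⟩ : ∃ k, (∃ x M b c D, Tup G N x M b c D ∧ M.length = k) ∧
      ∀ m, (∃ x M b c D, Tup G N x M b c D ∧ M.length = m) → k ≤ m := by
    classical
    exact ⟨Nat.find htup, Nat.find_spec htup, fun m hm => Nat.find_min' htup hm⟩
  have hmin : ∀ x' M' b' c' D', Tup G N x' M' b' c' D' → M.length ≤ M'.length := by
    intro x' M' b' c' D' h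
    rw [hk]
    exact hkmin _ ⟨x', M', b', c', D', h, rfl⟩
  obtain ⟨d, hd, hxd⟩ := (hT.nbr hN hmin).resolve_left (hno x)
  obtain ⟨d', hd', hbd'⟩ := (hT.rev.nbr hN (by simpa using hmin)).resolve_left (hno b)
  have hbc : G.Adj b c := hT.rev.2.2.1
  obtain ⟨h1, h2, h3, -⟩ := hT
  rw [List.isChain_append] at h1
  obtain ⟨hc1, hc2, hc3⟩ := h1
  have hc4 : (c :: D).IsChain G.Adj := (List.isChain_cons_cons.1 hc2).2
  have hDne : D ≠ [] := by rintro rfl; simp at hd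
  obtain ⟨e, D', rfl⟩ := List.exists_cons_of_ne_nil hDne
  have hce : G.Adj c e := (List.isChain_cons_cons.1 hc4).1
  have hc5 := (List.isChain_cons_cons.1 hc4).2
  obtain ⟨y, hy, hyb⟩ : ∃ y ∈ x :: M, G.Adj y b := by
    refine ⟨(x :: M).getLast (by simp), List.getLast_mem _, ?_⟩
    exact hc3 _ (List.getLast_mem_getLast? _) b (by simp)
  apply hG
  have hadj : ∀ i j : Fin 4, i < j → 
      ∃ a ∈ (![x :: M, [b], [c], e :: D'] i).toFinset, ∃ b₁ ∈ (![x :: M, [b], [c], e :: D'] j).toFinset, G.Adj a b₁ := by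
    intro i j hij
    fin_cases i <;> fin_cases j <;> first | (exact absurd hij (by decide)) | skip
    · exact ⟨y, by simpa using hy, b, by simp, hyb⟩
    · exact ⟨x, by simp, c, by simp, h3⟩
    · exact ⟨x, by simp, d, by simpa using hd, hxd⟩
    · exact ⟨b, by simp, c, by simp, hbc⟩
    · exact ⟨b, by simp, d', by simpa using hd', hbd'⟩
    · exact ⟨c, by simp, e, by simp, hce⟩
  have hdis : ∀ i j : Fin 4, i < j → 
      Disjoint (![x :: M, [b], [c], e :: D'] i).toFinset (![x :: M, [b], [c], e :: D'] j).toFinset := by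
    intro i j hij
    rw [List.nodup_append] at h2
    obtain ⟨-, h2, h2'⟩ := h2
    rw [List.nodup_cons, List.nodup_cons] at h2
    obtain ⟨hb, hc, -⟩ := h2
    rw [Finset.disjoint_left]
    intro z hz1 hz2
    fin_cases i <;> fin_cases j <;> first | (exact absurd hij (by decide)) | skip
    all_goals simp at hz1 hz2 h2' hb hc
    all_goals grind
  refine ⟨fun i => (![x :: M, [b], [c], e :: D'] i).toFinset, ?_, ?_, ?_, ?_⟩
  · intro i; fin_cases i <;> simp
  · intro i j hij
    rcases lt_or_gt_of_ne hij with h | h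
    · exact hdis i j h
    · exact (hdis j i h).symm
  · intro i
    apply chain_conn
    · fin_cases i <;> simp
    · fin_cases i
      · exact hc1
      · simp
      · simp
      · exact hc5
  · intro i j hij
    rcases lt_or_gt_of_ne hij with h | h
    · exact hadj i j h
    · obtain ⟨a, ha, b, hb, hab⟩ := hadj j i h
      exact ⟨b, hb, a, ha, hab.symm⟩

end GraphPart

/-! ### Part 2: connectivity of the fibres by quadratic moves -/

section FibrePart
set_option linter.unusedSectionVars false
variable {V : Type} [DecidableEq V] {ι : Type} [Fintype ι] [DecidableEq ι]

/-- indicator of disagreement -/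
def bc (x y : Bool) : ℕ := if x = y then 0 else 1

/-- indicator that the pair `u, w` is separated by the row `x` -/
def ct (x : V → Bool) (u w : V) : ℕ := bc (x u) (x w)

/-- number of rows separating `u, w` -/
def cnt (T : ι → V → Bool) (u w : V) : ℕ := ∑ i, ct (T i) u w

/-- same separation numbers on all edges -/
def SameCnt (G : SimpleGraph V) (T T' : ι → V → Bool) : Prop :=
  ∀ u w, G.Adj u w → cnt T u w = cnt T' u w

/-- quadratic moves -/
def Step (G : SimpleGraph V) (T T' : ι → V → Bool) : Prop :=
  ∃ i j, i ≠ j ∧ (∀ k, k ≠ i → k ≠ j → T k = T' k) ∧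
    ∀ u w, G.Adj u w → ct (T i) u w + ct (T j) u w = ct (T' i) u w + ct (T' j) u w

/-- connected by quadratic moves -/
def Conn (G : SimpleGraph V) (T T' : ι → V → Bool) : Prop := Relation.ReflTransGen (Step G) T T'

theorem bc_comm (x y : Bool) : bc x y = bc y x := by revert x y; decide

theorem ct_comm (x : V → Bool) (u w : V) : ct x u w = ct x w u := bc_comm _ _

theorem cnt_comm (T : ι → V → Bool) (u w : V) : cnt T u w = cnt T w u := by
  simp only [cnt, ct_comm]

theorem Step.symm {G : SimpleGraph V} {T T' : ι → V → Bool} (h : Step G T T') : Step G T' T := by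
  obtain ⟨i, j, h1, h2, h3⟩ := h
  exact ⟨i, j, h1, fun k hi hj => (h2 k hi hj).symm, fun u w h => (h3 u w h).symm⟩

theorem Conn.symm {G : SimpleGraph V} {T T' : ι → V → Bool} (h : Conn G T T') : Conn G T' T := by
  induction h with
  | refl => exact .refl
  | tail _ h ih => exact Relation.ReflTransGen.head h.symm ih

theorem sum_two {f g : ι → ℕ} {i j : ι} (hij : i ≠ j) (h : ∀ k, k ≠ i → k ≠ j → f k = g k) :
    ∑ k, f k + (g i + g j) = ∑ k, g k + (f i + f j) := by
  have key : ∀ f : ι → ℕ, ∑ k, f k = f i + (f j + ∑ k ∈ (Finset.univ.erase i).erase j, f k) := by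
    intro f
    rw [Finset.add_sum_erase _ _ (by simp [hij.symm]), Finset.add_sum_erase _ _ (by simp)]
  rw [key f, key g]
  have : ∑ k ∈ (Finset.univ.erase i).erase j, f k = ∑ k ∈ (Finset.univ.erase i).erase j, g k := by
    apply Finset.sum_congr rfl
    intro k hk
    simp at hk
    exact h k hk.2 hk.1
  omega

theorem Step.sameCnt {G : SimpleGraph V} {T T' : ι → V → Bool} (h : Step G T T') : SameCnt G T T' := by
  obtain ⟨i, j, h1, h2, h3⟩ := h
  intro u w huw
  have := sum_two (f := fun k => ct (T k) u w) (g := fun k => ct (T' k) u w) h1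
    (fun k hi hj => by simp only [h2 k hi hj])
  have h4 := h3 u w huw
  simp only [cnt]
  omega

theorem SameCnt.trans {G : SimpleGraph V} {T T' T'' : ι → V → Bool} (h : SameCnt G T T')
    (h' : SameCnt G T' T'') : SameCnt G T T'' := fun u w huw => (h u w huw).trans (h' u w huw)

theorem SameCnt.symm {G : SimpleGraph V} {T T' : ι → V → Bool} (h : SameCnt G T T') :
    SameCnt G T' T := fun u w huw => (h u w huw).symm

theorem Conn.sameCnt {G : SimpleGraph V} {T T' : ι → V → Bool} (h : Conn G T T') : SameCnt G T T' := by
  induction h with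
  | refl => exact fun _ _ _ => rfl
  | tail _ h ih => exact ih.trans h.sameCnt

theorem parity {H : SimpleGraph V} {a b : V} (hab : H.Reachable a b) {T T' : ι → V → Bool}
    (h : SameCnt H T T') : cnt T a b % 2 = cnt T' a b % 2 := by
  rw [SimpleGraph.reachable_iff_reflTransGen] at hab
  have hbc : ∀ x y z : Bool, ((bc x z : ℕ) : ZMod 2) = bc x y + bc y z := by decide
  have hadd : ∀ (T : ι → V → Bool) (u w z : V),
      ((cnt T u z : ℕ) : ZMod 2) = cnt T u w + cnt T w z := by
    intro T u w z
    simp only [cnt, Nat.cast_sum, ← Finset.sum_add_distrib]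
    exact Finset.sum_congr rfl fun i _ => hbc _ _ _
  have : ((cnt T a b : ℕ) : ZMod 2) = cnt T' a b := by
    induction hab with
    | refl => simp [cnt, ct, bc]
    | tail _ hbc ih =>
      rw [hadd T a _ _, hadd T' a _ _, ih, h _ _ hbc]
  exact (ZMod.natCast_eq_natCast_iff' _ _ 2).1 this

theorem parity_pair {H : SimpleGraph V} {a b : V} (hab : H.Reachable a b) {x y x' y' : V → Bool}
    (h : ∀ u w, H.Adj u w → ct x u w + ct y u w = ct x' u w + ct y' u w) :
    (ct x a b + ct y a b) % 2 = (ct x' a b + ct y' a b) % 2 := by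
  have := parity hab (T := fun t : Bool => if t then x else y) (T' := fun t : Bool => if t then x' else y')
    (by intro u w huw; simpa [cnt] using h u w huw)
  simpa [cnt] using this

theorem pair_ext {G : SimpleGraph V} {v a b : V} (hN : ∀ u, G.Adj v u ↔ u = a ∨ u = b)
    {x y x' y' : V → Bool}
    (h : ∀ u w, (delV G v).Adj u w → ct x u w + ct y u w = ct x' u w + ct y' u w)
    (ha : ct x v a + ct y v a = ct x' v a + ct y' v a)
    (hb : ct x v b + ct y v b = ct x' v b + ct y' v b) :
    ∀ u w, G.Adj u w → ct x u w + ct y u w = ct x' u w + ct y' u w := by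
  have hv : ∀ w, G.Adj v w → ct x v w + ct y v w = ct x' v w + ct y' v w := by
    intro w hw
    rcases (hN w).1 hw with rfl | rfl
    · exact ha
    · exact hb
  intro u w huw
  by_cases hu : u = v
  · subst hu; exact hv w huw
  · by_cases hw : w = v
    · subst hw
      simp only [ct_comm _ u w]
      exact hv u huw.symm
    · exact h u w ⟨huw, hu, hw⟩

/-- agreement off the column `v` -/
def Off (v : V) (T S : ι → V → Bool) : Prop := ∀ k u, u ≠ v → T k u = S k u

/-- flip the entry at `v` -/
def flipv (v : V) (x : V → Bool) : V → Bool := Function.update x v (!(x v))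

theorem flip_step {G : SimpleGraph V} {v a b : V} (hN : ∀ u, G.Adj v u ↔ u = a ∨ u = b)
    (T : ι → V → Bool) {i j : ι} (hij : i ≠ j) (ha : ct (T i) v a ≠ ct (T j) v a)
    (hb : ct (T i) v b ≠ ct (T j) v b) :
    Step G T (fun k => if k = i ∨ k = j then flipv v (T k) else T k) := by
  have hav : a ≠ v := by rintro rfl; exact G.irrefl ((hN _).2 (Or.inl rfl))
  have hbv : b ≠ v := by rintro rfl; exact G.irrefl ((hN _).2 (Or.inr rfl))
  refine ⟨i, j, hij, fun k hi hj => by simp [hi, hj], ?_⟩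
  apply pair_ext hN
  · intro u w h
    simp [flipv, ct, Function.update_of_ne h.2.1, Function.update_of_ne h.2.2]
  · simp [flipv, ct, Function.update_of_ne hav] at ha ⊢
    revert ha
    generalize T i v = p1; generalize T i a = p2; generalize T j v = p3; generalize T j a = p4
    revert p1 p2 p3 p4; decide
  · simp [flipv, ct, Function.update_of_ne hbv] at hb ⊢
    revert hb
    generalize T i v = p1; generalize T i b = p2; generalize T j v = p3; generalize T j b = p4
    revert p1 p2 p3 p4; decide

theorem exists_gt {f g : ι → ℕ} (h : ∑ k, f k = ∑ k, g k) {i : ι} (hi : f i < g i) :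
    ∃ j, g j < f j := by
  by_contra hc
  push Not at hc
  exact absurd h (Finset.sum_lt_sum (fun k _ => hc k) ⟨i, Finset.mem_univ _, hi⟩).ne

theorem perm_conn {G : SimpleGraph V} {v a b : V} (hN : ∀ u, G.Adj v u ↔ u = a ∨ u = b)
    (T T' : ι → V → Bool) (hoff : Off v T T') (ha : cnt T v a = cnt T' v a)
    (hb : cnt T v b = cnt T' v b) : Conn G T T' := by
  have hav : a ≠ v := by rintro rfl; exact G.irrefl ((hN _).2 (Or.inl rfl))
  have hbv : b ≠ v := by rintro rfl; exact G.irrefl ((hN _).2 (Or.inr rfl))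
  induction hn : (Finset.univ.filter (fun k => T k v ≠ T' k v)).card using Nat.strong_induction_on
    generalizing T with
  | _ n ih =>
  by_cases hall : ∀ k, T k v = T' k v
  · have : T = T' := by
      funext k u
      by_cases hu : u = v
      · subst hu; exact hall k
      · exact hoff k u hu
    rw [this]; exact .refl
  push Not at hall
  obtain ⟨i, hi⟩ := hall
  -- a partner
  have hpart : ∃ j, T j v ≠ T' j v ∧ ct (T i) v a ≠ ct (T j) v a ∧ ct (T i) v b ≠ ct (T j) v b := by
    have hs1 : ∑ k, (ct (T k) v a + ct (T k) v b) = ∑ k, (ct (T' k) v a + ct (T' k) v b) := by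
      rw [Finset.sum_add_distrib, Finset.sum_add_distrib]; exact congrArg₂ _ ha hb
    have hs2 : ∑ k, (ct (T k) v a + ct (T' k) v b) = ∑ k, (ct (T' k) v a + ct (T k) v b) := by
      rw [Finset.sum_add_distrib, Finset.sum_add_distrib]; exact congrArg₂ _ ha hb.symm
    have main : (∃ j, T j v ≠ T' j v ∧ bc (T i v) (T i a) ≠ bc (T j v) (T j a) ∧
        bc (T i v) (T i b) ≠ bc (T j v) (T j b)) := by
      simp only [ct, ← hoff _ _ hav, ← hoff _ _ hbv] at hs1 hs2
      have B1 : ∀ x a b x' : Bool, x ≠ x' → 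
        (bc x a + bc x b < bc x' a + bc x' b ∨ bc x' a + bc x' b < bc x a + bc x b) ∨
        (bc x a + bc x' b < bc x' a + bc x b ∨ bc x' a + bc x b < bc x a + bc x' b) := by decide
      have B2 : ∀ x a b x' : Bool, bc x a + bc x b < bc x' a + bc x' b → 
          x ≠ x' ∧ bc x a = 0 ∧ bc x b = 0 := by decide
      have B3 : ∀ x a b x' : Bool, bc x' a + bc x' b < bc x a + bc x b → 
          x ≠ x' ∧ bc x a = 1 ∧ bc x b = 1 := by decide
      have B4 : ∀ x a b x' : Bool, bc x a + bc x' b < bc x' a + bc x b → 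
          x ≠ x' ∧ bc x a = 0 ∧ bc x b = 1 := by decide
      have B5 : ∀ x a b x' : Bool, bc x' a + bc x b < bc x a + bc x' b → 
          x ≠ x' ∧ bc x a = 1 ∧ bc x b = 0 := by decide
      rcases B1 (T i v) (T i a) (T i b) (T' i v) hi with (h | h) | (h | h)
      · obtain ⟨j, hj⟩ := exists_gt hs1 h
        have h1 := B2 _ _ _ _ h; have h2 := B3 _ _ _ _ hj
        exact ⟨j, h2.1, by omega, by omega⟩
      · obtain ⟨j, hj⟩ := exists_gt hs1.symm h
        have h1 := B3 _ _ _ _ h; have h2 := B2 _ _ _ _ hj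
        exact ⟨j, h2.1, by omega, by omega⟩
      · obtain ⟨j, hj⟩ := exists_gt hs2 h
        have h1 := B4 _ _ _ _ h; have h2 := B5 _ _ _ _ hj
        exact ⟨j, h2.1, by omega, by omega⟩
      · obtain ⟨j, hj⟩ := exists_gt hs2.symm h
        have h1 := B5 _ _ _ _ h; have h2 := B4 _ _ _ _ hj
        exact ⟨j, h2.1, by omega, by omega⟩
    exact main
  obtain ⟨j, hj, hja, hjb⟩ := hpart
  have hij : i ≠ j := by rintro rfl; exact hja rfl
  have hst := flip_step hN T hij hja hjb
  refine Relation.ReflTransGen.head hst (ih _ ?_ _ ?_ ?_ ?_ rfl)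
  · rw [← hn]
    apply Finset.card_lt_card
    rw [Finset.ssubset_iff_of_subset]
    · refine ⟨i, by simpa using hi, ?_⟩
      intro hmem
      have h2 := (Finset.mem_filter.1 hmem).2
      simp only [true_or, if_true, flipv, Function.update_self] at h2
      revert hi h2
      clear * -
      generalize T i v = p; generalize T' i v = q
      revert p q; decide
    · intro k
      simp only [Finset.mem_filter, Finset.mem_univ, true_and]
      split_ifs with h
      · intro _
        rcases h with rfl | rfl
        · exact hi
        · exact hj
      · exact id
  · intro k u hu
    rw [← hoff k u hu]
    simp only
    split_ifs
    · simp [flipv, hu]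
    · rfl
  · rw [← ha]; exact (hst.sameCnt v a ((hN a).2 (Or.inl rfl))).symm
  · rw [← hb]; exact (hst.sameCnt v b ((hN b).2 (Or.inr rfl))).symm

theorem lift_aux {G : SimpleGraph V} {v a b : V} (hN : ∀ u, G.Adj v u ↔ u = a ∨ u = b)
    {T S S' : ι → V → Bool} (hoff : Off v T S) {i j : ι} (hij : i ≠ j)
    (hrest : ∀ k, k ≠ i → k ≠ j → S k = S' k)
    (hH : ∀ u w, (delV G v).Adj u w → ct (S i) u w + ct (S j) u w = ct (S' i) u w + ct (S' j) u w)
    (p q : Bool)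
    (ha : bc (T i v) (T i a) + bc (T j v) (T j a) = bc p (S' i a) + bc q (S' j a))
    (hb : bc (T i v) (T i b) + bc (T j v) (T j b) = bc p (S' i b) + bc q (S' j b)) :
    ∃ T2, Step G T T2 ∧ Off v T2 S' := by
  have hav : a ≠ v := by rintro rfl; exact G.irrefl ((hN _).2 (Or.inl rfl))
  have hbv : b ≠ v := by rintro rfl; exact G.irrefl ((hN _).2 (Or.inr rfl))
  refine ⟨fun k => if k = i then Function.update (S' i) v p else
    if k = j then Function.update (S' j) v q else T k, ⟨i, j, hij, ?_, ?_⟩, ?_⟩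
  · intro k hi hj; simp [hi, hj]
  · apply pair_ext hN
    · intro u w h
      have := hH u w h
      simp only [if_true, if_neg hij.symm, ct, Function.update_of_ne h.2.1,
        Function.update_of_ne h.2.2, hoff _ _ h.2.1, hoff _ _ h.2.2] at this ⊢
      exact this
    · simp only [if_true, if_neg hij.symm, ct, Function.update_of_ne hav, Function.update_self]
      exact ha
    · simp only [if_true, if_neg hij.symm, ct, Function.update_of_ne hbv, Function.update_self]
      exact hb
  · intro k u hu
    simp only
    split_ifs with h1 h2
    · subst h1; simp [hu]
    · subst h2; simp [hu]
    · rw [hoff k u hu, hrest k h1 h2]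

theorem bool_same : ∀ xa xb xv ya yb yv xa' xb' ya' yb' : Bool,
    bc xa xb + bc ya yb = bc xa' xb' + bc ya' yb' →
    ∃ p q, bc xv xa + bc yv ya = bc p xa' + bc q ya' ∧ bc xv xb + bc yv yb = bc p xb' + bc q yb' := by
  decide

theorem bool_down : ∀ xa xb xv ya yb yv xa' xb' ya' yb' : Bool,
    bc xa xb = 1 → bc ya yb = 1 → bc xa' xb' = 0 → bc ya' yb' = 0 → bc xv xa ≠ bc yv ya →
    ∃ p q, bc xv xa + bc yv ya = bc p xa' + bc q ya' ∧ bc xv xb + bc yv yb = bc p xb' + bc q yb' := by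
  decide

theorem lift_same {G : SimpleGraph V} {v a b : V} (hN : ∀ u, G.Adj v u ↔ u = a ∨ u = b)
    {T S S' : ι → V → Bool} (hoff : Off v T S) (hst : Step (delAdd G v a b) S S') :
    ∃ T2, Step G T T2 ∧ Off v T2 S' := by
  have hav : a ≠ v := by rintro rfl; exact G.irrefl ((hN _).2 (Or.inl rfl))
  have hbv : b ≠ v := by rintro rfl; exact G.irrefl ((hN _).2 (Or.inr rfl))
  obtain ⟨i, j, hij, h1, h2⟩ := hst
  have hab : ct (S i) a b + ct (S j) a b = ct (S' i) a b + ct (S' j) a b := by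
    by_cases h : a = b
    · subst h; simp [ct, bc]
    · exact h2 a b (Or.inr ⟨h, Or.inl ⟨rfl, rfl⟩⟩)
  obtain ⟨p, q, hp, hq⟩ := bool_same (T i a) (T i b) (T i v) (T j a) (T j b) (T j v)
    (S' i a) (S' i b) (S' j a) (S' j b) (by
      simpa only [ct, ← hoff _ _ hav, ← hoff _ _ hbv] using hab)
  exact lift_aux hN hoff hij h1 (fun u w h => h2 u w (Or.inl h)) p q hp hq

theorem lift_same_conn {G : SimpleGraph V} {v a b : V} (hN : ∀ u, G.Adj v u ↔ u = a ∨ u = b)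
    {T S S' : ι → V → Bool} (hoff : Off v T S) (hst : Conn (delAdd G v a b) S S') :
    ∃ T2, Conn G T T2 ∧ Off v T2 S' := by
  induction hst with
  | refl => exact ⟨T, .refl, hoff⟩
  | tail _ h ih =>
    obtain ⟨T2, h1, h2⟩ := ih
    obtain ⟨T3, h3, h4⟩ := lift_same hN h2 h
    exact ⟨T3, Relation.ReflTransGen.tail h1 h3, h4⟩

theorem lift_down {G : SimpleGraph V} {v a b : V} (hN : ∀ u, G.Adj v u ↔ u = a ∨ u = b)
    {T S S' T' : ι → V → Bool} (hoff : Off v T S) (hst : Step (delV G v) S S')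
    (hr : cnt S' a b + 2 = cnt S a b) (hT' : SameCnt G T T') (hr' : cnt T' a b ≤ cnt S' a b) :
    ∃ T2, Conn G T T2 ∧ Off v T2 S' := by
  have hav : a ≠ v := by rintro rfl; exact G.irrefl ((hN _).2 (Or.inl rfl))
  have hbv : b ≠ v := by rintro rfl; exact G.irrefl ((hN _).2 (Or.inr rfl))
  obtain ⟨i, j, hij, h1, h2⟩ := hst
  have hsum := sum_two (f := fun k => ct (S k) a b) (g := fun k => ct (S' k) a b) hij
    (fun k hi hj => by simp only [h1 k hi hj])
  have hle : ∀ (x : V → Bool) u w, ct x u w ≤ 1 := by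
    intro x u w; simp only [ct, bc]; split_ifs <;> omega
  have l1 := hle (S i) a b
  have l2 := hle (S j) a b
  change cnt S a b + (ct (S' i) a b + ct (S' j) a b) = cnt S' a b + (ct (S i) a b + ct (S j) a b) at hsum
  have e1 : ct (S i) a b = 1 := by omega
  have e2 : ct (S j) a b = 1 := by omega
  have e3 : ct (S' i) a b = 0 := by omega
  have e4 : ct (S' j) a b = 0 := by omega
  have hTS : ∀ T : ι → V → Bool, Off v T S → ∀ k, ct (T k) a b = ct (S k) a b := by
    intro T hT k; simp only [ct, hT k a hav, hT k b hbv]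
  have fin : ∀ T : ι → V → Bool, Off v T S → ct (T i) v a ≠ ct (T j) v a →
      ∃ T2, Step G T T2 ∧ Off v T2 S' := by
    intro T hT hne
    obtain ⟨p, q, hp, hq⟩ := bool_down (T i a) (T i b) (T i v) (T j a) (T j b) (T j v)
      (S' i a) (S' i b) (S' j a) (S' j b) ((hTS T hT i).trans e1) ((hTS T hT j).trans e2) e3 e4 hne
    exact lift_aux hN hT hij h1 h2 p q hp hq
  by_cases hne : ct (T i) v a = ct (T j) v a
  swap
  · obtain ⟨T2, h3, h4⟩ := fin T hoff hne
    exact ⟨T2, Relation.ReflTransGen.single h3, h4⟩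
  have B1 : ∀ x a b : Bool, bc a b = 0 → bc x a = bc x b := by decide
  have B2 : ∀ x a b : Bool, bc a b = 1 → bc x a + bc x b = 1 := by decide
  have B3 : ∀ x a b : Bool, bc x a ≤ bc x b + bc a b ∧ bc x b ≤ bc x a + bc a b := by decide
  have hk : ∃ k, ct (T k) a b = 1 ∧ ct (T k) v a ≠ ct (T i) v a := by
    by_contra hcon
    push Not at hcon
    have hpa := hT' v a ((hN a).2 (Or.inl rfl))
    have hpb := hT' v b ((hN b).2 (Or.inr rfl))
    have hrT : cnt T a b = cnt S a b := by
      simp only [cnt]; exact Finset.sum_congr rfl fun k _ => hTS T hoff k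
    have g1 : cnt T' v a ≤ cnt T' v b + cnt T' a b := by
      simp only [cnt, ← Finset.sum_add_distrib]
      exact Finset.sum_le_sum fun k _ => (B3 _ _ _).1
    have g2 : cnt T' v b ≤ cnt T' v a + cnt T' a b := by
      simp only [cnt, ← Finset.sum_add_distrib]
      exact Finset.sum_le_sum fun k _ => (B3 _ _ _).2
    rcases Nat.lt_or_ge 0 (ct (T i) v a) with ht | ht
    · have : cnt T v a = cnt T v b + cnt T a b := by
        simp only [cnt, ← Finset.sum_add_distrib]
        refine Finset.sum_congr rfl fun k _ => ?_
        have q1 := hle (T k) a b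
        have q2 := hcon k
        have q3 := B1 (T k v) (T k a) (T k b)
        have q4 := B2 (T k v) (T k a) (T k b)
        have q5 := hle (T k) v a
        simp only [ct] at *
        omega
      omega
    · have : cnt T v b = cnt T v a + cnt T a b := by
        simp only [cnt, ← Finset.sum_add_distrib]
        refine Finset.sum_congr rfl fun k _ => ?_
        have q1 := hle (T k) a b
        have q2 := hcon k
        have q3 := B1 (T k v) (T k a) (T k b)
        have q4 := B2 (T k v) (T k a) (T k b)
        have q5 := hle (T k) v a
        simp only [ct] at *
        omega
      omega
  obtain ⟨k, hk1, hk2⟩ := hk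
  have hki : k ≠ i := by rintro rfl; exact hk2 rfl
  have hkj : k ≠ j := by rintro rfl; exact hk2 hne.symm
  have hst := flip_step hN T (i := j) (j := k) hkj.symm (by rw [← hne]; exact hk2.symm) (by
    have q4 := B2 (T k v) (T k a) (T k b) hk1
    have q5 := B2 (T j v) (T j a) (T j b) ((hTS T hoff j).trans e2)
    simp only [ct] at *
    omega)
  obtain ⟨T2, h3, h4⟩ := fin (fun l => if l = j ∨ l = k then flipv v (T l) else T l) (by
    intro l u hu
    rw [← hoff l u hu]
    simp only
    split_ifs
    · simp [flipv, hu]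
    · rfl) (by
    simp only [true_or, if_true, hij, hki.symm, or_self, if_false]
    have B : ∀ x a : Bool, bc x a ≠ bc (!x) a := by decide
    rw [hne]
    simp only [ct, flipv, Function.update_self, Function.update_of_ne hav]
    exact B _ _ )
  exact ⟨T2, (Relation.ReflTransGen.single hst).tail h3, h4⟩

theorem conn_edgeless [Nontrivial ι] {G : SimpleGraph V} (hG : ∀ u w, ¬ G.Adj u w)
    (T T' : ι → V → Bool) : Conn G T T' := by
  have key : ∀ s : Finset ι, Conn G T (fun k => if k ∈ s then T' k else T k) := by
    intro s
    induction s using Finset.induction_on with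
    | empty => simp; exact .refl
    | insert i s hi ih =>
      refine Relation.ReflTransGen.tail ih ?_
      obtain ⟨j, hj⟩ := exists_ne i
      refine ⟨i, j, hj.symm, ?_, fun u w h => absurd h (hG u w)⟩
      intro k hk _
      simp [hk]
  simpa using key Finset.univ

theorem conn_of_good {G : SimpleGraph V} {v a b : V} (hN : ∀ u, G.Adj v u ↔ u = a ∨ u = b)
    (hab : (delV G v).Reachable a b)
    (ih1 : ∀ T T' : ι → V → Bool, SameCnt (delV G v) T T' → Conn (delV G v) T T')
    (ih2 : ∀ T T' : ι → V → Bool, SameCnt (delAdd G v a b) T T' → Conn (delAdd G v a b) T T')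
    {T T' : ι → V → Bool} (h : SameCnt G T T') (hle : cnt T' a b ≤ cnt T a b) : Conn G T T' := by
  have hsub : ∀ {S S' : ι → V → Bool}, SameCnt G S S' → SameCnt (delV G v) S S' :=
    fun h u w huw => h u w huw.1
  -- same level
  have hlev : ∀ T1 S S' : ι → V → Bool, Off v T1 S → SameCnt (delV G v) S S' →
      cnt S a b = cnt S' a b → ∃ T2, Conn G T1 T2 ∧ Off v T2 S' := by
    intro T1 S S' hoff hS hr
    apply lift_same_conn hN hoff
    apply ih2
    rintro u w (huw | ⟨-, ⟨rfl, rfl⟩ | ⟨rfl, rfl⟩⟩)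
    · exact hS u w huw
    · exact hr
    · rw [cnt_comm S, cnt_comm S']; exact hr
  have main : ∀ S, Conn (delV G v) T S → ∀ S2, SameCnt (delV G v) T S2 →
      cnt S2 a b ≤ cnt T a b → cnt S a b ≤ cnt S2 a b → cnt T' a b ≤ cnt S2 a b →
      ∃ T1, Conn G T T1 ∧ Off v T1 S2 := by
    intro S hS
    induction hS with
    | refl =>
      intro S2 hS2 h1 h2 h3
      exact hlev T T S2 (fun _ _ _ => rfl) hS2 (le_antisymm h2 h1)
    | @tail S S1 hTS hst ih =>
      intro S2 hS2 h1 h2 h3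
      by_cases hle2 : cnt S a b ≤ cnt S2 a b
      · exact ih S2 hS2 h1 hle2 h3
      have hTS' := Conn.sameCnt hTS
      have p1 := parity hab hS2
      have p2 := parity hab hTS'
      have p3 := parity hab hst.sameCnt
      have hdrop : cnt S a b ≤ cnt S1 a b + 2 := by
        obtain ⟨i, j, hij, k1, k2⟩ := hst
        have hsum := sum_two (f := fun k => ct (S k) a b) (g := fun k => ct (S1 k) a b) hij
          (fun k hi hj => by simp only [k1 k hi hj])
        have hle : ∀ (x : V → Bool) u w, ct x u w ≤ 1 := by
          intro x u w; simp only [ct, bc]; split_ifs <;> omega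
        have l1 := hle (S i) a b
        have l2 := hle (S j) a b
        change cnt S a b + (ct (S1 i) a b + ct (S1 j) a b) =
          cnt S1 a b + (ct (S i) a b + ct (S j) a b) at hsum
        omega
      by_cases hST : cnt S a b ≤ cnt T a b
      · obtain ⟨T1, hT1, hoff1⟩ := ih S hTS' hST le_rfl (by omega)
        obtain ⟨T2, hT2, hoff2⟩ := lift_down hN hoff1 hst (by omega)
          ((Conn.sameCnt hT1).symm.trans h) (by omega)
        obtain ⟨T3, hT3, hoff3⟩ := hlev T2 S1 S2 hoff2
          ((hTS'.trans hst.sameCnt).symm.trans hS2) (by omega)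
        exact ⟨T3, (Relation.ReflTransGen.trans hT1 hT2).trans hT3, hoff3⟩
      · exact hlev T T S2 (fun _ _ _ => rfl) hS2 (by omega)
  obtain ⟨T1, hT1, hoff⟩ := main T' (ih1 T T' (hsub h)) T' (hsub h) hle le_rfl le_rfl
  have h1 := (Conn.sameCnt hT1).symm.trans h
  exact Relation.ReflTransGen.trans hT1 (perm_conn hN T1 T' hoff (h1 v a ((hN a).2 (Or.inl rfl)))
    (h1 v b ((hN b).2 (Or.inr rfl))))

theorem conn_of_minor_free [Fintype V] [Nontrivial ι] (G : SimpleGraph V) (hG : ¬ HasK4Minor G)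
    (T T' : ι → V → Bool) (h : SameCnt G T T') : Conn G T T' := by
  classical
  induction hn : (Finset.univ.filter (fun u => ∃ w, G.Adj u w)).card using Nat.strong_induction_on
    generalizing G T T' with
  | _ n ih =>
  by_cases hE : ∃ u w, G.Adj u w
  swap
  · push Not at hE
    exact conn_edgeless hE T T'
  obtain ⟨v, a, b, hN, hab⟩ := exists_good_vertex G hG hE
  have hva := (hN a).2 (Or.inl rfl)
  have hvb := (hN b).2 (Or.inr rfl)
  have hm2 : ¬ HasK4Minor (delAdd G v a b) := fun h => hG (minor_delAdd hva hvb h)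
  have hm1 : ¬ HasK4Minor (delV G v) := fun h => hG (minor_mono (G := delV G v) (fun _ _ h => h.1) h)
  have card_lt : ∀ H : SimpleGraph V, (∀ w, ¬ H.Adj v w) →
      (∀ u w, H.Adj u w → ∃ z, G.Adj u z) →
      (Finset.univ.filter (fun u => ∃ w, H.Adj u w)).card < n := by
    intro H h1 h2
    rw [← hn]
    apply Finset.card_lt_card
    rw [Finset.ssubset_iff_of_subset]
    · exact ⟨v, by simpa using ⟨a, hva⟩, by simpa using h1⟩
    · intro u
      simp only [Finset.mem_filter, Finset.mem_univ, true_and]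
      rintro ⟨w, hw⟩
      exact h2 u w hw
  have ih1 : ∀ T T' : ι → V → Bool, SameCnt (delV G v) T T' → Conn (delV G v) T T' := by
    intro S S' hS
    refine ih _ (card_lt (delV G v) ?_ ?_) _ hm1 S S' hS rfl
    · intro w hw; exact hw.2.1 rfl
    · intro u w hw; exact ⟨w, hw.1⟩
  have ih2 : ∀ T T' : ι → V → Bool, SameCnt (delAdd G v a b) T T' → Conn (delAdd G v a b) T T' := by
    intro S S' hS
    refine ih _ (card_lt (delAdd G v a b) ?_ ?_) _ hm2 S S' hS rfl
    · rintro w (hw | ⟨-, ⟨rfl, -⟩ | ⟨rfl, -⟩⟩)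
      · exact hw.2.1 rfl
      · exact G.irrefl hva
      · exact G.irrefl hvb
    · rintro u w (hw | ⟨-, ⟨rfl, -⟩ | ⟨rfl, -⟩⟩)
      · exact ⟨w, hw.1⟩
      · exact ⟨v, hva.symm⟩
      · exact ⟨v, hvb.symm⟩
  rcases le_total (cnt T' a b) (cnt T a b) with hle | hle
  · exact conn_of_good hN hab ih1 ih2 h hle
  · exact (conn_of_good hN hab ih1 ih2 h.symm hle).symm

end FibrePart

/-! ### Part 3: from fibres to ideals -/

section AlgPart
set_option linter.unusedSectionVars false

theorem toric_ker {σ τ K : Type} [Field K] (φ : MvPolynomial σ K →ₐ[K] MvPolynomial τ K)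
    (d : (σ →₀ ℕ) → (τ →₀ ℕ)) (hd : ∀ m, φ (monomial m 1) = monomial (d m) 1)
    (J : Ideal (MvPolynomial σ K))
    (hJ : ∀ m m', d m = d m' → (monomial m 1 - monomial m' 1 : MvPolynomial σ K) ∈ J) :
    RingHom.ker φ ≤ J := by
  let R : MvPolynomial τ K →ₗ[K] MvPolynomial σ K :=
    (basisMonomials τ K).constr K (fun e => monomial (Function.invFun d e) 1)
  have hR : ∀ e, R (monomial e 1) = monomial (Function.invFun d e) 1 := by
    intro e
    have := (basisMonomials τ K).constr_basis K (fun e => (monomial (Function.invFun d e) 1 : MvPolynomial σ K)) e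
    rwa [coe_basisMonomials] at this
  have key : ∀ p, p - R (φ p) ∈ J := by
    intro p
    induction p using MvPolynomial.induction_on' with
    | monomial u a =>
      have h1 : (monomial u a : MvPolynomial σ K) = a • monomial u 1 := by
        rw [smul_monomial, smul_eq_mul, mul_one]
      rw [h1, map_smul, hd, map_smul, hR, ← smul_sub, MvPolynomial.smul_eq_C_mul]
      apply Ideal.mul_mem_left
      apply hJ
      exact (Function.invFun_eq ⟨u, rfl⟩).symm
    | add p q hp hq =>
      have : p + q - R (φ (p + q)) = (p - R (φ p)) + (q - R (φ q)) := by
        rw [map_add, map_add]; ring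
      rw [this]
      exact J.add_mem hp hq
  intro p hp
  have := key p
  rw [RingHom.mem_ker] at hp
  rw [hp, map_zero, sub_zero] at this
  exact this

theorem monomial_as_prod {σ K : Type} [Field K] (m : σ →₀ ℕ) :
    ∃ (n : ℕ) (A : Fin n → σ), (monomial m 1 : MvPolynomial σ K) = ∏ i, X (A i) := by
  induction m using Finsupp.induction_linear with
  | zero => exact ⟨0, Fin.elim0, by simp⟩
  | add f g hf hg =>
    obtain ⟨n, A, hA⟩ := hf
    obtain ⟨k, B, hB⟩ := hg
    refine ⟨n + k, Fin.append A B, ?_⟩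
    rw [Fin.prod_univ_add]
    simp only [Fin.append_left, Fin.append_right]
    rw [← hA, ← hB, monomial_mul, mul_one]
  | single a k =>
    refine ⟨k, fun _ => a, ?_⟩
    simp [X_pow_eq_monomial]

variable {K : Type} [Field K] {V : Type} [Fintype V] [DecidableEq V]

/-- the 0/1 row of a cut -/
def rowOf {v₀ : V} (A : {A : Finset V // v₀ ∈ A}) : V → Bool := fun u => decide (u ∈ A.1)

/-- the cut of a 0/1 row -/
def mkCut (v₀ : V) (x : V → Bool) : {A : Finset V // v₀ ∈ A} :=
  ⟨Finset.univ.filter (fun u => x u = x v₀), by simp⟩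

theorem mkCut_rowOf {v₀ : V} (A : {A : Finset V // v₀ ∈ A}) : mkCut v₀ (rowOf A) = A := by
  apply Subtype.ext
  ext u
  simp [mkCut, rowOf, A.2]

theorem sep_mkCut (v₀ : V) (x : V → Bool) (u w : V) :
    sep (mkCut v₀ x).1 s(u, w) = (x u).xor (x w) := by
  have : ∀ p q r : Bool, (decide (p = r)).xor (decide (q = r)) = p.xor q := by decide
  simp only [sep, mkCut, Sym2.lift_mk, Finset.mem_filter, Finset.mem_univ, true_and]
  exact this _ _ _

theorem ct_eq_sep (v₀ : V) (x : V → Bool) (u w : V) :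
    ct x u w = if sep (mkCut v₀ x).1 s(u, w) = true then 1 else 0 := by
  rw [sep_mkCut]
  simp only [ct]
  generalize x u = p; generalize x w = q
  revert p q; decide

/-- the quadratic part -/
def quadPart (K : Type) [Field K] (G : SimpleGraph V) (v₀ : V) :
    Set (MvPolynomial {A : Finset V // v₀ ∈ A} K) :=
  {p | p ∈ cutIdeal K G v₀ ∧ p.totalDegree ≤ 2}

theorem cutMap_X (G : SimpleGraph V) (v₀ : V) (A : {A : Finset V // v₀ ∈ A}) :
    cutMap K G v₀ (X A) = ∏ e ∈ (Set.toFinite G.edgeSet).toFinset, X (e, sep A.1 e) := by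
  simp [cutMap]

theorem quad_mem (G : SimpleGraph V) (v₀ : V) (x y x' y' : V → Bool)
    (h : ∀ u w, G.Adj u w → ct x u w + ct y u w = ct x' u w + ct y' u w) :
    (X (mkCut v₀ x) * X (mkCut v₀ y) - X (mkCut v₀ x') * X (mkCut v₀ y') :
      MvPolynomial {A : Finset V // v₀ ∈ A} K) ∈ quadPart K G v₀ := by
  constructor
  · rw [cutIdeal, RingHom.mem_ker, map_sub, map_mul, map_mul, sub_eq_zero]
    simp only [cutMap_X, ← Finset.prod_mul_distrib]
    refine Finset.prod_congr rfl ?_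
    intro e he
    rw [Set.Finite.mem_toFinset] at he
    induction e using Sym2.inductionOn with
    | _ u w =>
    have h1 := h u w he
    simp only [ct_eq_sep v₀] at h1
    revert h1
    generalize sep (mkCut v₀ x).1 s(u, w) = p1
    generalize sep (mkCut v₀ y).1 s(u, w) = p2
    generalize sep (mkCut v₀ x').1 s(u, w) = p3
    generalize sep (mkCut v₀ y').1 s(u, w) = p4
    cases p1 <;> cases p2 <;> cases p3 <;> cases p4 <;> simp [mul_comm]
  · refine (totalDegree_sub _ _).trans (max_le ?_ ?_)
    · refine (totalDegree_mul _ _).trans ?_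
      simp [totalDegree_X]
    · refine (totalDegree_mul _ _).trans ?_
      simp [totalDegree_X]

/-- the monomial of a table -/
def tabProd (K : Type) [Field K] (v₀ : V) {ι : Type} [Fintype ι] (T : ι → V → Bool) :
    MvPolynomial {A : Finset V // v₀ ∈ A} K := ∏ i, X (mkCut v₀ (T i))

theorem step_mem {ι : Type} [Fintype ι] [DecidableEq ι] (G : SimpleGraph V) (v₀ : V)
    {T T' : ι → V → Bool} (h : Step G T T') :
    tabProd K v₀ T - tabProd K v₀ T' ∈ Ideal.span (quadPart K G v₀) := by
  obtain ⟨i, j, hij, h1, h2⟩ := h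
  have key : ∀ T : ι → V → Bool, tabProd K v₀ T = 
      (X (mkCut v₀ (T i)) * X (mkCut v₀ (T j))) * ∏ k ∈ (Finset.univ.erase i).erase j, X (mkCut v₀ (T k)) := by
    intro T
    rw [mul_assoc, Finset.mul_prod_erase _ (fun k => (X (mkCut v₀ (T k)) : MvPolynomial _ K)) (by simp [hij.symm]),
      Finset.mul_prod_erase _ (fun k => (X (mkCut v₀ (T k)) : MvPolynomial _ K)) (by simp)]
    rfl
  have hrest : ∏ k ∈ (Finset.univ.erase i).erase j, (X (mkCut v₀ (T k)) : MvPolynomial _ K) =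
      ∏ k ∈ (Finset.univ.erase i).erase j, X (mkCut v₀ (T' k)) := by
    apply Finset.prod_congr rfl
    intro k hk
    simp at hk
    rw [h1 k hk.2 hk.1]
  rw [key T, key T', hrest, ← sub_mul]
  exact Ideal.mul_mem_right _ _ (Ideal.subset_span (quad_mem G v₀ _ _ _ _ h2))

theorem conn_mem {ι : Type} [Fintype ι] [DecidableEq ι] (G : SimpleGraph V) (v₀ : V)
    {T T' : ι → V → Bool} (h : Conn G T T') :
    tabProd K v₀ T - tabProd K v₀ T' ∈ Ideal.span (quadPart K G v₀) := by
  induction h with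
  | refl => simp
  | @tail S S' _ h ih =>
    have := Ideal.add_mem _ ih (step_mem (K := K) G v₀ h)
    simpa using this

/-- exponent of the image of a variable -/
def cutExp (G : SimpleGraph V) (A : Finset V) : Sym2 V × Bool →₀ ℕ :=
  ∑ e ∈ (Set.toFinite G.edgeSet).toFinset, Finsupp.single (e, sep A e) 1

theorem cutMap_X_exp (G : SimpleGraph V) (v₀ : V) (A : {A : Finset V // v₀ ∈ A}) :
    cutMap K G v₀ (X A) = monomial (cutExp G A.1) 1 := by
  rw [cutMap_X, cutExp, monomial_sum_one]
  rfl

theorem cutExp_apply (G : SimpleGraph V) (A : Finset V) (e : Sym2 V) (he : e ∈ G.edgeSet) (t : Bool) :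
    cutExp G A (e, t) = if sep A e = t then 1 else 0 := by
  classical
  rw [cutExp, Finsupp.finsetSum_apply]
  rw [Finset.sum_eq_single e]
  · simp [Finsupp.single_apply]
  · intro b _ hb
    rw [Finsupp.single_apply, if_neg]
    intro h
    exact hb (Prod.ext_iff.1 h).1
  · intro h
    exact absurd ((Set.Finite.mem_toFinset _).2 he) h

theorem mem_of_image_eq (G : SimpleGraph V) (v₀ : V) (hG : ¬ HasK4Minor G) {n n' : ℕ}
    (A : Fin n → {A : Finset V // v₀ ∈ A}) (A' : Fin n' → {A : Finset V // v₀ ∈ A})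
    (h : cutMap K G v₀ (∏ i, X (A i)) = cutMap K G v₀ (∏ i, X (A' i))) :
    (∏ i, X (A i) - ∏ i, X (A' i) : MvPolynomial {A : Finset V // v₀ ∈ A} K) ∈
      Ideal.span (quadPart K G v₀) := by
  by_cases hE : ∃ u w, G.Adj u w
  swap
  · -- no edges
    push Not at hE
    have h1 : ∀ B : {A : Finset V // v₀ ∈ A}, cutMap K G v₀ (X B) = 1 := by
      intro B
      rw [cutMap_X]
      apply Finset.prod_eq_one
      intro e he
      rw [Set.Finite.mem_toFinset] at he
      induction e using Sym2.inductionOn with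
      | _ u w => exact absurd he (hE u w)
    have h2 : ∀ B : {A : Finset V // v₀ ∈ A}, (X B - 1 : MvPolynomial _ K) ∈
        Ideal.span (quadPart K G v₀) := by
      intro B
      refine Ideal.subset_span ⟨?_, ?_⟩
      · rw [cutIdeal, RingHom.mem_ker, map_sub, h1, map_one, sub_self]
      · refine (totalDegree_sub _ _).trans (max_le ?_ ?_) <;> simp [totalDegree_X]
    have h3 : ∀ (k : ℕ) (B : Fin k → {A : Finset V // v₀ ∈ A}), (∏ i, X (B i) - 1 : MvPolynomial _ K) ∈
        Ideal.span (quadPart K G v₀) := by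
      intro k B
      rw [← Ideal.Quotient.mk_eq_mk_iff_sub_mem]
      rw [map_prod, map_one]
      apply Finset.prod_eq_one
      intro i _
      rw [← map_one (Ideal.Quotient.mk (Ideal.span (quadPart K G v₀))), Ideal.Quotient.mk_eq_mk_iff_sub_mem]
      exact h2 _
    have := Ideal.sub_mem _ (h3 n A) (h3 n' A')
    simpa using this
  -- exponents
  have hexp : ∀ (k : ℕ) (B : Fin k → {A : Finset V // v₀ ∈ A}),
      cutMap K G v₀ (∏ i, X (B i)) = monomial (∑ i, cutExp G (B i).1) 1 := by
    intro k B
    rw [map_prod, monomial_sum_one]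
    exact Finset.prod_congr rfl fun i _ => cutMap_X_exp G v₀ (B i)
  rw [hexp, hexp] at h
  have hs := monomial_left_injective (R := K) one_ne_zero h
  have hc : ∀ e ∈ G.edgeSet, ∀ t, ∑ i, (if sep (A i).1 e = t then 1 else 0) =
      ∑ i, (if sep (A' i).1 e = t then 1 else 0) := by
    intro e he t
    have := DFunLike.congr_fun hs (e, t)
    rw [Finsupp.finsetSum_apply, Finsupp.finsetSum_apply] at this
    simpa only [cutExp_apply G _ e he] using this
  obtain ⟨u, w, huw⟩ := hE
  have hnn : n = n' := by
    have h1 := hc s(u, w) huw true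
    have h2 := hc s(u, w) huw false
    have h3 : ∀ (k : ℕ) (B : Fin k → {A : Finset V // v₀ ∈ A}),
      ∑ i, (if sep (B i).1 s(u, w) = true then 1 else 0) +
        ∑ i, (if sep (B i).1 s(u, w) = false then 1 else 0) = k := by
      intro k B
      rw [← Finset.sum_add_distrib]
      rw [Finset.sum_congr rfl (g := fun _ => 1)]
      · simp
      · intro i _
        cases sep (B i).1 s(u, w) <;> simp
    have h4 := h3 n A
    have h5 := h3 n' A'
    omega
  subst hnn
  have hA : ∀ B : Fin n → {A : Finset V // v₀ ∈ A},
      (∏ i, X (B i) : MvPolynomial _ K) = tabProd K v₀ (fun i => rowOf (B i)) := by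
    intro B
    simp only [tabProd, mkCut_rowOf]
  have hsame : SameCnt G (fun i => rowOf (A i)) (fun i => rowOf (A' i)) := by
    intro u w huw
    have := hc s(u, w) huw true
    simp only [cnt, ct_eq_sep v₀, mkCut_rowOf]
    exact this
  match n, A, A', h, hs, hc, hA, hsame with
  | 0, A, A', _, _, _, _, _ => simp
  | 1, A, A', h, hs, hc, hA, hsame =>
    refine Ideal.subset_span ⟨?_, ?_⟩
    · rw [cutIdeal, RingHom.mem_ker, map_sub, hexp, hexp, hs, sub_self]
    · refine (totalDegree_sub _ _).trans (max_le ?_ ?_) <;> simp [totalDegree_X]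
  | n + 2, A, A', h, hs, hc, hA, hsame =>
    rw [hA A, hA A']
    exact conn_mem G v₀ (conn_of_minor_free G hG _ _ hsame)

theorem quad_of_minor_free (G : SimpleGraph V) (v₀ : V) (hG : ¬ HasK4Minor G) :
    Ideal.span (quadPart K G v₀) = cutIdeal K G v₀ := by
  apply le_antisymm
  · rw [Ideal.span_le]
    intro p hp
    exact hp.1
  · have hd : ∀ m, ∃ e, cutMap K G v₀ (monomial m 1) = monomial e 1 := by
      intro m
      obtain ⟨n, A, hA⟩ := monomial_as_prod (K := K) m
      refine ⟨∑ i, cutExp G (A i).1, ?_⟩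
      rw [hA, map_prod, monomial_sum_one]
      exact Finset.prod_congr rfl fun i _ => cutMap_X_exp G v₀ (A i)
    choose d hd using hd
    apply toric_ker (cutMap K G v₀) d hd
    intro m m' hmm
    obtain ⟨n, A, hA⟩ := monomial_as_prod (K := K) m
    obtain ⟨n', A', hA'⟩ := monomial_as_prod (K := K) m'
    rw [hA, hA']
    apply mem_of_image_eq G v₀ hG
    rw [← hA, ← hA', hd, hd, hmm]

end AlgPart

/-! ### Part 4: a `K₄` minor forces a generator of higher degree -/

section MinorPart
set_option linter.unusedSectionVars false

theorem low_ker {σ τ K : Type} [Field K] (φ : MvPolynomial σ K →ₐ[K] MvPolynomial τ K)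
    (d : (σ →₀ ℕ) → (τ →₀ ℕ)) (hd : ∀ m, φ (monomial m 1) = monomial (d m) 1)
    (ψ : MvPolynomial σ K →ₐ[K] K)
    (hψ : ∀ m m' : σ →₀ ℕ, m.degree ≤ 2 → m'.degree ≤ 2 → d m = d m' →
      ψ (monomial m 1) = ψ (monomial m' 1))
    (p : MvPolynomial σ K) (hp : φ p = 0) (hdeg : p.totalDegree ≤ 2) : ψ p = 0 := by
  classical
  let F : (τ →₀ ℕ) → K := fun e =>
    if h : ∃ m : σ →₀ ℕ, m.degree ≤ 2 ∧ d m = e then ψ (monomial h.choose 1) else 0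
  have hF : ∀ m : σ →₀ ℕ, m.degree ≤ 2 → F (d m) = ψ (monomial m 1) := by
    intro m hm
    have h : ∃ m' : σ →₀ ℕ, m'.degree ≤ 2 ∧ d m' = d m := ⟨m, hm, rfl⟩
    simp only [F]
    rw [dif_pos h]
    exact hψ _ _ h.choose_spec.1 hm h.choose_spec.2
  let R : MvPolynomial τ K →ₗ[K] K := (basisMonomials τ K).constr K F
  have hR : ∀ e, R (monomial e 1) = F e := by
    intro e
    have := (basisMonomials τ K).constr_basis K F e
    rwa [coe_basisMonomials] at this
  have hsm : ∀ m (a : K), (monomial m a : MvPolynomial σ K) = a • monomial m 1 := by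
    intro m a
    rw [smul_monomial, smul_eq_mul, mul_one]
  have h1 : R (φ p) = ψ p := by
    conv_lhs => rw [p.as_sum]
    conv_rhs => rw [p.as_sum]
    rw [map_sum, map_sum, map_sum]
    refine Finset.sum_congr rfl fun m hm => ?_
    rw [hsm m, map_smul, map_smul, map_smul, hd, hR, hF]
    have := le_totalDegree hm
    rw [Finsupp.degree_apply]
    exact le_trans this hdeg
  rw [← h1, hp, map_zero]

theorem monomial_as_prod_deg {σ K : Type} [Field K] (m : σ →₀ ℕ) :
    ∃ (A : Fin m.degree → σ), (monomial m 1 : MvPolynomial σ K) = ∏ i, X (A i) := by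
  obtain ⟨n, A, hA⟩ := monomial_as_prod (K := K) m
  have h1 : (∏ i, X (A i) : MvPolynomial σ K) = monomial (∑ i, Finsupp.single (A i) 1) 1 := by
    rw [monomial_sum_one]; rfl
  have h2 := monomial_left_injective (R := K) one_ne_zero (hA.trans h1)
  have h3 : m.degree = n := by
    rw [h2, map_sum]
    simp
  subst h3
  exact ⟨A, hA⟩

variable {K : Type} [Field K] {V : Type} [Fintype V] [DecidableEq V]

/-- number of chosen cross edges cut by `A` -/
def nCut (a : Fin 4 → Fin 4 → V) (A : Finset V) : ℕ :=
  ∑ ij ∈ ({(0,1), (0,2), (0,3), (1,2), (1,3), (2,3)} : Finset (Fin 4 × Fin 4)),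
    if sep A s(a ij.1 ij.2, a ij.2 ij.1) = true then 1 else 0

/-- `A` cuts no edge inside a branch set -/
def innerFree (G : SimpleGraph V) (W : Fin 4 → Finset V) (A : Finset V) : Prop :=
  ∀ i, ∀ u ∈ W i, ∀ w ∈ W i, G.Adj u w → sep A s(u, w) = false

/-- good cuts -/
def goodCut (G : SimpleGraph V) (W : Fin 4 → Finset V) (a : Fin 4 → Fin 4 → V)
    (A : Finset V) : Prop := innerFree G W A ∧ nCut a A ≠ 3

theorem sep_mk (A : Finset V) (u w : V) :
    sep A s(u, w) = (decide (u ∈ A)).xor (decide (w ∈ A)) := rfl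

theorem nCut_val (G : SimpleGraph V) (W : Fin 4 → Finset V) (a : Fin 4 → Fin 4 → V)
    (hconn : ∀ i, (G.comap (Subtype.val : {x : V // x ∈ W i} → V)).Connected)
    (ha : ∀ i j, i ≠ j → a i j ∈ W i) (A : Finset V) (hA : innerFree G W A) :
    nCut a A = 0 ∨ nCut a A = 3 ∨ nCut a A = 4 := by
  have hconst : ∀ i, ∀ u ∈ W i, ∀ w ∈ W i, decide (u ∈ A) = decide (w ∈ A) := by
    intro i u hu w hw
    have := root_of_conn G (W i) (hconn i) u w hu hw
    induction this with
    | refl => rfl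
    | tail _ h ih =>
      have h2 := hA i _ h.2.1 _ h.2.2 h.1
      rw [sep_mk] at h2
      rw [ih h.2.1]
      simpa using h2
  have h0 : ∀ i, ∃ b, ∀ u ∈ W i, decide (u ∈ A) = b := by
    intro i
    by_cases h : (W i).Nonempty
    · obtain ⟨r, hr⟩ := h
      exact ⟨decide (r ∈ A), fun u hu => hconst i u hu r hr⟩
    · exact ⟨true, fun u hu => absurd ⟨u, hu⟩ h⟩
  choose b hb using h0
  have hn : nCut a A =
      ∑ ij ∈ ({(0,1), (0,2), (0,3), (1,2), (1,3), (2,3)} : Finset (Fin 4 × Fin 4)),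
        if (b ij.1).xor (b ij.2) = true then 1 else 0 := by
    refine Finset.sum_congr rfl fun ij hij => ?_
    have hne : ij.1 ≠ ij.2 := by
      revert ij; decide
    rw [sep_mk, hb _ _ (ha _ _ hne), hb _ _ (ha _ _ hne.symm)]
  rw [hn]
  clear hn hb hconst
  revert b
  decide

theorem good_one (G : SimpleGraph V) (W : Fin 4 → Finset V) (a : Fin 4 → Fin 4 → V)
    (hadj : ∀ i j, i ≠ j → G.Adj (a i j) (a j i)) (A B : Finset V)
    (h : ∀ e ∈ G.edgeSet, sep A e = sep B e) (hA : goodCut G W a A) : goodCut G W a B := by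
  refine ⟨fun i u hu w hw huw => ?_, ?_⟩
  · rw [← h _ huw]; exact hA.1 i u hu w hw huw
  · have : nCut a B = nCut a A := by
      refine Finset.sum_congr rfl fun ij hij => ?_
      have hne : ij.1 ≠ ij.2 := by
        revert ij; decide
      rw [h _ (hadj _ _ hne)]
    rw [this]; exact hA.2

theorem good_two (G : SimpleGraph V) (W : Fin 4 → Finset V) (a : Fin 4 → Fin 4 → V)
    (hconn : ∀ i, (G.comap (Subtype.val : {x : V // x ∈ W i} → V)).Connected)
    (ha : ∀ i j, i ≠ j → a i j ∈ W i)
    (hadj : ∀ i j, i ≠ j → G.Adj (a i j) (a j i)) (A B A' B' : Finset V)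
    (h : ∀ e ∈ G.edgeSet, (if sep A e = true then 1 else 0) + (if sep B e = true then 1 else 0) =
      (if sep A' e = true then 1 else 0) + (if sep B' e = true then 1 else 0))
    (hA : goodCut G W a A) (hB : goodCut G W a B) : goodCut G W a A' ∧ goodCut G W a B' := by
  have hin : innerFree G W A' ∧ innerFree G W B' := by
    constructor
    · intro i u hu w hw huw
      have h1 := h s(u, w) huw
      rw [hA.1 i u hu w hw huw, hB.1 i u hu w hw huw] at h1
      by_contra h2
      rw [Bool.not_eq_false] at h2
      rw [h2] at h1
      simp at h1
      omega
    · intro i u hu w hw huw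
      have h1 := h s(u, w) huw
      rw [hA.1 i u hu w hw huw, hB.1 i u hu w hw huw] at h1
      by_contra h2
      rw [Bool.not_eq_false] at h2
      rw [h2] at h1
      simp at h1
  have hs : nCut a A + nCut a B = nCut a A' + nCut a B' := by
    simp only [nCut]
    rw [← Finset.sum_add_distrib, ← Finset.sum_add_distrib]
    refine Finset.sum_congr rfl fun ij hij => ?_
    have hne : ij.1 ≠ ij.2 := by
      revert ij; decide
    exact h _ (hadj _ _ hne)
  have h1 := nCut_val G W a hconn ha A hA.1
  have h2 := nCut_val G W a hconn ha B hB.1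
  have h3 := nCut_val G W a hconn ha A' hin.1
  have h4 := nCut_val G W a hconn ha B' hin.2
  have h5 := hA.2
  have h6 := hB.2
  exact ⟨⟨hin.1, by omega⟩, ⟨hin.2, by omega⟩⟩

open Classical in
/-- evaluation at the indicator of good cuts -/
def goodEval (K : Type) [Field K] (G : SimpleGraph V) (v₀ : V) (W : Fin 4 → Finset V)
    (a : Fin 4 → Fin 4 → V) : MvPolynomial {A : Finset V // v₀ ∈ A} K →ₐ[K] K :=
  aeval fun A => if goodCut G W a A.1 then 1 else 0

open Classical in
theorem ite_one_mul_ite (P Q : Prop) :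
    ((if P then 1 else 0) * (if Q then 1 else 0) : K) = if P ∧ Q then 1 else 0 := by
  by_cases P <;> by_cases Q <;> simp [*]

theorem goodEval_low (G : SimpleGraph V) (v₀ : V) (W : Fin 4 → Finset V) (a : Fin 4 → Fin 4 → V)
    (hconn : ∀ i, (G.comap (Subtype.val : {x : V // x ∈ W i} → V)).Connected)
    (ha : ∀ i j, i ≠ j → a i j ∈ W i)
    (hadj : ∀ i j, i ≠ j → G.Adj (a i j) (a j i))
    (p : MvPolynomial {A : Finset V // v₀ ∈ A} K) (hp : p ∈ cutIdeal K G v₀)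
    (hdeg : p.totalDegree ≤ 2) : goodEval K G v₀ W a p = 0 := by
  classical
  have hexp : ∀ (k : ℕ) (B : Fin k → {A : Finset V // v₀ ∈ A}),
      cutMap K G v₀ (∏ i, X (B i)) = monomial (∑ i, cutExp G (B i).1) 1 := by
    intro k B
    rw [map_prod, monomial_sum_one]
    exact Finset.prod_congr rfl fun i _ => cutMap_X_exp G v₀ (B i)
  have hd : ∀ m, ∃ e, cutMap K G v₀ (monomial m 1) = monomial e 1 := by
    intro m
    obtain ⟨n, A, hA⟩ := monomial_as_prod (K := K) m
    exact ⟨∑ i, cutExp G (A i).1, by rw [hA, hexp]⟩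
  choose d hd using hd
  refine low_ker (cutMap K G v₀) d hd _ ?_ p hp hdeg
  intro m m' hm hm' hmm
  obtain ⟨A, hA⟩ := monomial_as_prod_deg (K := K) m
  obtain ⟨A', hA'⟩ := monomial_as_prod_deg (K := K) m'
  rw [hA, hA']
  have h : cutMap K G v₀ (∏ i, X (A i)) = cutMap K G v₀ (∏ i, X (A' i)) := by
    rw [← hA, ← hA', hd, hd, hmm]
  clear hA hA' hmm
  revert A A' hm hm'
  generalize m.degree = n
  generalize m'.degree = n'
  intro hn hn' A A' h
  rw [hexp, hexp] at h
  have hs := monomial_left_injective (R := K) one_ne_zero h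
  have hc : ∀ e ∈ G.edgeSet, ∀ t, ∑ i, (if sep (A i).1 e = t then 1 else 0) =
      ∑ i, (if sep (A' i).1 e = t then 1 else 0) := by
    intro e he t
    have := DFunLike.congr_fun hs (e, t)
    rw [Finsupp.finsetSum_apply, Finsupp.finsetSum_apply] at this
    simpa only [cutExp_apply G _ e he] using this
  have hnn : n = n' := by
    have huw := hadj 0 1 (by decide)
    have h1 := hc s(a 0 1, a 1 0) huw true
    have h2 := hc s(a 0 1, a 1 0) huw false
    have h3 : ∀ (e : Sym2 V) (k : ℕ) (B : Fin k → {A : Finset V // v₀ ∈ A}),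
      ∑ i, (if sep (B i).1 e = true then 1 else 0) +
        ∑ i, (if sep (B i).1 e = false then 1 else 0) = k := by
      intro e k B
      rw [← Finset.sum_add_distrib]
      rw [Finset.sum_congr rfl (g := fun _ => 1)]
      · simp
      · intro i _
        cases sep (B i).1 e <;> simp
    have h4 := h3 s(a 0 1, a 1 0) n A
    have h5 := h3 s(a 0 1, a 1 0) n' A'
    omega
  subst hnn
  match n, A, A', hn, hc with
  | 0, A, A', _, _ => simp
  | 1, A, A', _, hc =>
    simp only [Fin.prod_univ_one, Fin.sum_univ_one, goodEval, aeval_X] at hc ⊢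
    have h1 : ∀ e ∈ G.edgeSet, sep (A 0).1 e = sep (A' 0).1 e := by
      intro e he
      have := hc e he true
      revert this
      generalize sep (A 0).1 e = x
      generalize sep (A' 0).1 e = y
      revert x y
      decide
    have : goodCut G W a (A 0).1 ↔ goodCut G W a (A' 0).1 :=
      ⟨good_one G W a hadj _ _ h1, good_one G W a hadj _ _ fun e he => (h1 e he).symm⟩
    simp only [this]
  | 2, A, A', _, hc =>
    simp only [Fin.prod_univ_two, Fin.sum_univ_two, goodEval, aeval_X, map_mul] at hc ⊢
    have : (goodCut G W a (A 0).1 ∧ goodCut G W a (A 1).1) ↔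
        (goodCut G W a (A' 0).1 ∧ goodCut G W a (A' 1).1) :=
      ⟨fun h => good_two G W a hconn ha hadj _ _ _ _ (fun e he => hc e he true) h.1 h.2,
       fun h => good_two G W a hconn ha hadj _ _ _ _ (fun e he => (hc e he true).symm) h.1 h.2⟩
    rw [ite_one_mul_ite, ite_one_mul_ite]
    simp only [this]
  | n + 3, _, _, hn, _ => omega

theorem minor_not_quad (G : SimpleGraph V) (v₀ : V) (hG : HasK4Minor G)
    (S : Set (MvPolynomial {A : Finset V // v₀ ∈ A} K)) (hS : Ideal.span S = cutIdeal K G v₀)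
    (hdeg : ∀ p ∈ S, p.totalDegree ≤ 2) : False := by
  classical
  obtain ⟨W, hne, hdisj, hconn, hedge⟩ := hG
  have : Nonempty V := ⟨v₀⟩
  choose! a ha b hb hab using hedge
  -- symmetrise the choice of edges
  obtain ⟨c, hc, hadj⟩ : ∃ c : Fin 4 → Fin 4 → V, (∀ i j, i ≠ j → c i j ∈ W i) ∧
      (∀ i j, i ≠ j → G.Adj (c i j) (c j i)) := by
    refine ⟨fun i j => if i < j then a i j else b j i, ?_, ?_⟩
    · intro i j hij
      dsimp only
      split_ifs
      · exact ha i j hij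
      · exact hb j i hij.symm
    · intro i j hij
      dsimp only
      rcases lt_or_gt_of_ne hij with h | h
      · rw [if_pos h, if_neg (not_lt.2 h.le)]
        exact hab i j hij
      · rw [if_neg (not_lt.2 h.le), if_pos h]
        exact (hab j i hij.symm).symm
  have hle : cutIdeal K G v₀ ≤ RingHom.ker (goodEval K G v₀ W c) := by
    rw [← hS, Ideal.span_le]
    intro p hp
    have : p ∈ cutIdeal K G v₀ := by
      rw [← hS]; exact Ideal.subset_span hp
    exact goodEval_low G v₀ W c hconn hc hadj p this (hdeg p hp)
  obtain ⟨g, hg⟩ : ∃ g : V → Fin 4, ∀ i, ∀ u ∈ W i, g u = i := by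
    refine ⟨fun u => if h : ∃ i, u ∈ W i then h.choose else 0, fun i u hu => ?_⟩
    have h : ∃ i, u ∈ W i := ⟨i, hu⟩
    dsimp only
    rw [dif_pos h]
    by_contra hne'
    exact Finset.disjoint_left.1 (hdisj _ _ hne') h.choose_spec hu
  let Q : (Fin 4 → Bool) → MvPolynomial {A : Finset V // v₀ ∈ A} K :=
    fun x => X (mkCut v₀ (fun u => x (g u)))
  have hQ : ∀ x : Fin 4 → Bool, goodEval K G v₀ W c (Q x) =
      if ∑ ij ∈ ({(0,1), (0,2), (0,3), (1,2), (1,3), (2,3)} : Finset (Fin 4 × Fin 4)),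
        (if (x ij.1).xor (x ij.2) = true then 1 else 0) ≠ 3 then 1 else 0 := by
    intro x
    simp only [Q, goodEval, aeval_X]
    have h1 : innerFree G W (mkCut v₀ (fun u => x (g u))).1 := by
      intro i u hu w hw _
      rw [sep_mkCut, hg i u hu, hg i w hw, Bool.xor_self]
    have h2 : nCut c (mkCut v₀ (fun u => x (g u))).1 =
        ∑ ij ∈ ({(0,1), (0,2), (0,3), (1,2), (1,3), (2,3)} : Finset (Fin 4 × Fin 4)),
        (if (x ij.1).xor (x ij.2) = true then 1 else 0) := by
      refine Finset.sum_congr rfl fun ij hij => ?_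
      have hne : ij.1 ≠ ij.2 := by
        revert ij; decide
      rw [sep_mkCut, hg _ _ (hc _ _ hne), hg _ _ (hc _ _ hne.symm)]
    rw [goodCut, h2]
    simp only [h1, true_and]
  let p : MvPolynomial {A : Finset V // v₀ ∈ A} K :=
    Q ![false, false, false, false] * Q ![false, true, true, false] *
      Q ![false, true, false, true] * Q ![false, false, true, true] -
    Q ![false, true, false, false] * Q ![false, false, true, false] *
      Q ![false, false, false, true] * Q ![false, true, true, true]
  have hp : p ∈ cutIdeal K G v₀ := by
    rw [cutIdeal, RingHom.mem_ker]
    simp only [p, Q, map_sub, map_mul]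
    rw [sub_eq_zero]
    simp only [cutMap_X, ← Finset.prod_mul_distrib]
    refine Finset.prod_congr rfl fun e _ => ?_
    induction e using Sym2.inductionOn with
    | _ u w =>
    simp only [sep_mkCut]
    generalize g u = i
    generalize g w = j
    generalize s(u, w) = e
    fin_cases i <;> fin_cases j <;> simp <;> ring
  have h0 := hle hp
  rw [RingHom.mem_ker] at h0
  simp only [p, map_sub, map_mul, hQ] at h0
  rw [if_pos (by decide), if_pos (by decide), if_pos (by decide), if_pos (by decide),
    if_neg (by decide)] at h0
  simp at h0

end MinorPart

/-- Conjecture 3.5 of Sturmfels and Sullivant: the cut ideal `I_G` is generated by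
polynomials of degree at most `2` if and only if `G` has no `K₄` minor. -/
theorem cutIdeal_quadrics_iff_K4_minor_free
    (K : Type) [Field K] {V : Type} [Fintype V] [DecidableEq V]
    (G : SimpleGraph V) (v₀ : V) :
    (∃ S : Set (MvPolynomial {A : Finset V // v₀ ∈ A} K),
      Ideal.span S = cutIdeal K G v₀ ∧ ∀ p ∈ S, p.totalDegree ≤ 2) ↔
    ¬ HasK4Minor G := by
  constructor
  · rintro ⟨S, hS, hdeg⟩ hminor
    exact minor_not_quad G v₀ hminor S hS hdeg
  · intro hG
    exact ⟨quadPart K G v₀, quad_of_minor_free G v₀ hG, fun p hp => hp.2⟩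

end
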